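/- arXiv:1311.4174 — 2 statements merged into one kernel-verified Lean document; each statement's English description precedes it below -/
import Mathlib

section
/- Let X be a real inner product space with the induced metric dist a b = ‖a − b‖, let C be a nonempty convex subset of X, and let x, y ∈ X. Suppose u, v ∈ C satisfy dist(x, u) = inf_{c ∈ C} dist(x, c) and dist(y, v) = inf_{c ∈ C} dist(y, c) (i.e., u and v are the metric projections of x and y onto C). Then, with the quasilinearization map ⟨→ab, →cd⟩ := (1/2)(dist(a,d)² + dist(b,c)² − dist(a,c)² − dist(b,d)²), one has ⟨→xy, →uv⟩ ≥ dist(u, v)², i.e., the metric projection onto C is firmly nonexpansive. -/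
/-- Quasilinearization map of Berg and Nikolaev. -/
noncomputable def quasilin {X : Type*} [PseudoMetricSpace X] (a b c d : X) : ℝ :=
  (1 / 2) * (dist a d ^ 2 + dist b c ^ 2 - dist a c ^ 2 - dist b d ^ 2)

/-- The obtuse-angle characterization of a nearest point of a convex set. -/
theorem real_inner_le_zero_of_dist_eq_infDist {X : Type*} [NormedAddCommGroup X]
    [InnerProductSpace ℝ X] {C : Set X} (hconv : Convex ℝ C) {x u w : X} (hu : u ∈ C)
    (hw : w ∈ C) (hpu : dist x u = Metric.infDist x C) : inner ℝ (x - u) (w - u) ≤ 0 := by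
  refine (norm_eq_iInf_iff_real_inner_le_zero hconv hu).1 ?_ w hw
  simpa only [Metric.infDist_eq_iInf, dist_eq_norm] using hpu

/-- In a real inner product space the quasilinearization map is the inner product. -/
theorem quasilin_eq_inner {X : Type*} [NormedAddCommGroup X] [InnerProductSpace ℝ X]
    (a b c d : X) : quasilin a b c d = inner ℝ (b - a) (d - c) := by
  simp only [quasilin, dist_eq_norm, ← real_inner_self_eq_norm_sq, inner_sub_left,
    inner_sub_right, real_inner_comm a, real_inner_comm b c, real_inner_comm b d]
  ring

theorem metric_projection_firmly_nonexpansive {X : Type*} [NormedAddCommGroup X]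
    [InnerProductSpace ℝ X] (C : Set X) (hC : C.Nonempty) (hconv : Convex ℝ C)
    (x y u v : X) (hu : u ∈ C) (hv : v ∈ C)
    (hpu : dist x u = Metric.infDist x C) (hpv : dist y v = Metric.infDist y C) :
    dist u v ^ 2 ≤ quasilin x y u v := by
  rw [quasilin_eq_inner, dist_eq_norm, ← real_inner_self_eq_norm_sq]
  have hxu := real_inner_le_zero_of_dist_eq_infDist hconv hu hv hpu
  have hyv := real_inner_le_zero_of_dist_eq_infDist hconv hv hu hpv
  have hsplit : inner ℝ (y - x) (v - u) - inner ℝ (u - v) (u - v) =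
      -inner ℝ (x - u) (v - u) - inner ℝ (y - v) (u - v) := by
    simp only [inner_sub_left, inner_sub_right]
    ring
  linarith
end

section
/- Let X be a real inner product space with the induced metric dist a b = ‖a − b‖, let C be a nonempty convex subset of X, and let x, y ∈ X. Suppose u, v ∈ C satisfy dist(x, u) = inf_{c ∈ C} dist(x, c) and dist(y, v) = inf_{c ∈ C} dist(y, c). Then, with the quasilinearization map ⟨→ab, →cd⟩ := (1/2)(dist(a,d)² + dist(b,c)² − dist(a,c)² − dist(b,d)²), one has ⟨→xy, →uv⟩ ≥ 0, i.e., the metric projection onto C is monotone. -/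
theorem metric_projection_monotone {X : Type*} [NormedAddCommGroup X]
    [InnerProductSpace ℝ X] (C : Set X) (hC : C.Nonempty) (hconv : Convex ℝ C)
    (x y u v : X) (hu : u ∈ C) (hv : v ∈ C)
    (hpu : dist x u = Metric.infDist x C) (hpv : dist y v = Metric.infDist y C) :
    0 ≤ quasilin x y u v := by
  have hxuv : dist x u ≤ dist x v := hpu ▸ Metric.infDist_le_dist_of_mem hv
  have hyvu : dist y v ≤ dist y u := hpv ▸ Metric.infDist_le_dist_of_mem hu
  have hx_sq : dist x u ^ 2 ≤ dist x v ^ 2 := by gcongr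
  have hy_sq : dist y v ^ 2 ≤ dist y u ^ 2 := by gcongr
  unfold quasilin
  linarith
end
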